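/- arXiv:2003.05263 — 8 statements merged into one kernel-verified Lean document; each statement's English description precedes it below -/
import Mathlib

section
/- Let A be a unital associative real algebra and let A_ℂ := ℂ ⊗[ℝ] A be its complexification, regarded as a complex algebra, with canonical embedding a ↦ (1:ℂ) ⊗ₜ a. For every a ∈ A and every z ∈ ℂ, the complex number z belongs to the spectrum (over ℂ) of (1:ℂ) ⊗ₜ a in A_ℂ if and only if the element (algebraMap ℝ A z.re − a)^2 + algebraMap ℝ A (z.im^2) is not a unit of A. -/
open TensorProduct

/-- The real part `z ⊗ₜ a ↦ z.re • a` on the complexification of a real algebra. -/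
noncomputable def complexificationRe (A : Type*) [Ring A] [Algebra ℝ A] : ℂ ⊗[ℝ] A →ₗ[ℝ] A :=
  (TensorProduct.lid ℝ A).toLinearMap ∘ₗ Complex.reLm.rTensor A

theorem complexificationRe_tmul {A : Type*} [Ring A] [Algebra ℝ A] (z : ℂ) (a : A) :
    complexificationRe A (z ⊗ₜ[ℝ] a) = z.re • a := by
  simp [complexificationRe]

theorem complexificationRe_one_tmul_mul {A : Type*} [Ring A] [Algebra ℝ A] (d : A)
    (w : ℂ ⊗[ℝ] A) :
    complexificationRe A ((1 : ℂ) ⊗ₜ[ℝ] d * w) = d * complexificationRe A w := by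
  induction w with
  | zero => simp
  | tmul z a => simp [complexificationRe_tmul]
  | add x y hx hy => simp [mul_add, hx, hy]

theorem complexificationRe_mul_one_tmul {A : Type*} [Ring A] [Algebra ℝ A] (d : A)
    (w : ℂ ⊗[ℝ] A) :
    complexificationRe A (w * (1 : ℂ) ⊗ₜ[ℝ] d) = complexificationRe A w * d := by
  induction w with
  | zero => simp
  | tmul z a => simp [complexificationRe_tmul]
  | add x y hx hy => simp [add_mul, hx, hy]

theorem isUnit_one_tmul_complex_iff {A : Type*} [Ring A] [Algebra ℝ A] (d : A) :
    IsUnit ((1 : ℂ) ⊗ₜ[ℝ] d) ↔ IsUnit d := by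
  refine ⟨fun h => ?_, fun h => h.map (Algebra.TensorProduct.includeRight : A →ₐ[ℝ] ℂ ⊗[ℝ] A)⟩
  obtain ⟨w, hw, hw'⟩ := isUnit_iff_exists.mp h
  refine isUnit_iff_exists.mpr ⟨complexificationRe A w, ?_, ?_⟩
  · rw [← complexificationRe_one_tmul_mul, hw, Algebra.TensorProduct.one_def,
      complexificationRe_tmul, Complex.one_re, one_smul]
  · rw [← complexificationRe_mul_one_tmul, hw', Algebra.TensorProduct.one_def,
      complexificationRe_tmul, Complex.one_re, one_smul]

theorem tmul_one_sub_mul_conj {A : Type*} [Ring A] [Algebra ℝ A] (a : A) (z : ℂ) :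
    (z ⊗ₜ[ℝ] (1 : A) - (1 : ℂ) ⊗ₜ[ℝ] a) *
        ((starRingEnd ℂ z) ⊗ₜ[ℝ] (1 : A) - (1 : ℂ) ⊗ₜ[ℝ] a) =
      (1 : ℂ) ⊗ₜ[ℝ] ((algebraMap ℝ A z.re - a) ^ 2 + algebraMap ℝ A (z.im ^ 2)) := by
  have hd : (algebraMap ℝ A z.re - a) ^ 2 + algebraMap ℝ A (z.im ^ 2) =
      Complex.normSq z • (1 : A) - (2 * z.re) • a + a * a := by
    simp only [Complex.normSq_apply, sq, sub_mul, mul_sub, Algebra.algebraMap_eq_smul_one,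
      smul_mul_assoc, mul_smul_comm, one_mul, mul_one]
    module
  have hc : z ⊗ₜ[ℝ] a + (starRingEnd ℂ z) ⊗ₜ[ℝ] a = (1 : ℂ) ⊗ₜ[ℝ] ((2 * z.re) • a) := by
    rw [← add_tmul, Complex.add_conj, ← smul_tmul, Complex.real_smul, mul_one]
  have hn : (z * starRingEnd ℂ z) ⊗ₜ[ℝ] (1 : A) =
      (1 : ℂ) ⊗ₜ[ℝ] (Complex.normSq z • (1 : A)) := by
    rw [Complex.mul_conj, ← smul_tmul, Complex.real_smul, mul_one]
  rw [hd, tmul_add, tmul_sub, ← hc, ← hn]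
  simp only [sub_mul, mul_sub, Algebra.TensorProduct.tmul_mul_tmul, one_mul, mul_one]
  abel

theorem isUnit_conj_tmul_one_sub {A : Type*} [Ring A] [Algebra ℝ A] {a : A} {z : ℂ}
    (h : IsUnit (z ⊗ₜ[ℝ] (1 : A) - (1 : ℂ) ⊗ₜ[ℝ] a)) :
    IsUnit ((starRingEnd ℂ z) ⊗ₜ[ℝ] (1 : A) - (1 : ℂ) ⊗ₜ[ℝ] a) := by
  simpa using h.map (Algebra.TensorProduct.map Complex.conjAe.toAlgHom (AlgHom.id ℝ A))

theorem spectrum_complexification_iff (A : Type*) [Ring A] [Algebra ℝ A] (a : A) (z : ℂ) :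
    z ∈ spectrum ℂ ((1 : ℂ) ⊗ₜ[ℝ] a : ℂ ⊗[ℝ] A) ↔
      ¬ IsUnit ((algebraMap ℝ A z.re - a) ^ 2 + algebraMap ℝ A (z.im ^ 2)) := by
  rw [spectrum.mem_iff, Algebra.TensorProduct.algebraMap_apply, Algebra.algebraMap_self_apply,
    not_iff_not, ← isUnit_one_tmul_complex_iff (_ + _), ← tmul_one_sub_mul_conj]
  have hcomm : Commute (z ⊗ₜ[ℝ] (1 : A) - (1 : ℂ) ⊗ₜ[ℝ] a)
      ((starRingEnd ℂ z) ⊗ₜ[ℝ] (1 : A) - (1 : ℂ) ⊗ₜ[ℝ] a) := by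
    have h := tmul_one_sub_mul_conj a (starRingEnd ℂ z)
    rw [Complex.conj_conj, Complex.conj_re, Complex.conj_im, neg_sq] at h
    exact (tmul_one_sub_mul_conj a z).trans h.symm
  rw [hcomm.isUnit_mul_iff]
  exact ⟨fun h => ⟨h, isUnit_conj_tmul_one_sub h⟩, And.left⟩
end

section
/- Let A be a unital associative real algebra and let A_ℂ := ℂ ⊗[ℝ] A be its complexification. An element a ∈ A is a unit of A if and only if (1:ℂ) ⊗ₜ a is a unit of A_ℂ. -/
open TensorProduct

theorem isUnit_one_tmul_iff_of_faithfullyFlat {R S A : Type*} [CommRing R] [Ring S] [Algebra R S]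
    [Module.FaithfullyFlat R S] [Ring A] [Algebra R A] (a : A) :
    IsUnit ((1 : S) ⊗ₜ[R] a) ↔ IsUnit a := by
  have h : (LinearMap.mulLeft R a).lTensor S = LinearMap.mulLeft R ((1 : S) ⊗ₜ[R] a) := by
    ext s b
    simp
  have h_bij := Module.FaithfullyFlat.lTensor_bijective_iff_bijective R S (LinearMap.mulLeft R a)
  rw [h] at h_bij
  exact IsUnit.isUnit_iff_mulLeft_bijective.trans
    (h_bij.trans IsUnit.isUnit_iff_mulLeft_bijective.symm)

theorem isUnit_iff_isUnit_complexification (A : Type*) [Ring A] [Algebra ℝ A] (a : A) :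
    IsUnit a ↔ IsUnit ((1 : ℂ) ⊗ₜ[ℝ] a : ℂ ⊗[ℝ] A) :=
  (isUnit_one_tmul_iff_of_faithfullyFlat a).symm
end

section
/- Let ℍ := Quaternion ℝ and let M := ℂ ⊗[ℝ] ℍ be the complexification of the quaternion algebra. For every x ∈ ℍ, the spectrum of (1:ℂ) ⊗ₜ x in M equals the two-point set {(x.re : ℂ) + ‖x.im‖ * Complex.I, (x.re : ℂ) − ‖x.im‖ * Complex.I}. -/
open TensorProduct

/-- If `b` has a conjugate `c` with scalar trace `t` and norm `n`, and `c` is a scalar only when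
it equals `b`, then the spectrum of `b` is the zero set of `z ^ 2 - t * z + n`. -/
theorem spectrum.mem_iff_quadratic_eq_zero {K A : Type*} [Field K] [Ring A] [Algebra K A]
    [Nontrivial A] {b c : A} {t n : K} (hadd : b + c = algebraMap K A t)
    (hmul : b * c = algebraMap K A n) (hmul' : c * b = algebraMap K A n)
    (hscalar : ∀ z, algebraMap K A z = c → algebraMap K A z = b) (z : K) :
    z ∈ spectrum K b ↔ z ^ 2 - t * z + n = 0 := by
  have hr : (algebraMap K A z - b) * (algebraMap K A z - c) =
      algebraMap K A (z ^ 2 - t * z + n) := by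
    simp only [map_add, map_sub, map_mul, ← hadd, ← hmul, sub_mul, mul_sub, add_mul, sq,
      ← Algebra.commutes z c, ← Algebra.commutes z b]
    abel
  have hl : (algebraMap K A z - c) * (algebraMap K A z - b) =
      algebraMap K A (z ^ 2 - t * z + n) := by
    simp only [map_add, map_sub, map_mul, ← hadd, ← hmul', sub_mul, mul_sub, add_mul, sq,
      ← Algebra.commutes z c, ← Algebra.commutes z b]
    abel
  rw [spectrum.mem_iff, not_iff_comm]
  constructor
  · intro h0
    have hu : IsUnit ((algebraMap K A z - b) * (algebraMap K A z - c)) :=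
      hr ▸ (IsUnit.mk0 _ h0).map (algebraMap K A)
    exact ((show Commute _ _ from hr.trans hl.symm).isUnit_mul_iff.mp hu).1
  · intro hu h0
    rw [h0, map_zero] at hr
    exact hu.ne_zero (sub_eq_zero.mpr (hscalar z (sub_eq_zero.mp (hu.mul_right_eq_zero.mp hr))))

/-- Quaternion conjugation, extended to the complexification as the identity on `ℂ`. -/
noncomputable def complexifiedConj : ℂ ⊗[ℝ] Quaternion ℝ →ₗ[ℝ] ℂ ⊗[ℝ] Quaternion ℝ :=
  LinearMap.lTensor ℂ
    ((MulOpposite.opLinearEquiv ℝ).symm.toLinearMap ∘ₗ Quaternion.starAe.toLinearMap)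

theorem complexifiedConj_tmul (z : ℂ) (x : Quaternion ℝ) :
    complexifiedConj (z ⊗ₜ[ℝ] x) = z ⊗ₜ[ℝ] star x :=
  rfl

theorem Quaternion.normSq_eq_re_sq_add_norm_im_sq (x : Quaternion ℝ) :
    Quaternion.normSq x = x.re ^ 2 + ‖x.im‖ ^ 2 := by
  rw [sq ‖x.im‖, ← Quaternion.normSq_eq_norm_mul_self]
  simp [Quaternion.normSq_def']
  ring

theorem one_tmul_quaternion_coe (r : ℝ) :
    (1 : ℂ) ⊗ₜ[ℝ] (r : Quaternion ℝ) = (r : ℂ) ⊗ₜ[ℝ] (1 : Quaternion ℝ) := by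
  rw [← Quaternion.algebraMap_def, Algebra.algebraMap_eq_smul_one, ← smul_tmul]
  simp

theorem spectrum_quaternion_complexification (x : Quaternion ℝ) :
    spectrum ℂ ((1 : ℂ) ⊗ₜ[ℝ] x : ℂ ⊗[ℝ] Quaternion ℝ) =
      {(x.re : ℂ) + ‖x.im‖ * Complex.I, (x.re : ℂ) - ‖x.im‖ * Complex.I} := by
  ext z
  have hfactor : z ^ 2 - (2 * x.re : ℝ) * z + (Quaternion.normSq x : ℝ) =
      (z - (x.re + ‖x.im‖ * Complex.I)) * (z - (x.re - ‖x.im‖ * Complex.I)) := by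
    rw [Quaternion.normSq_eq_re_sq_add_norm_im_sq]
    push_cast
    linear_combination (‖x.im‖ : ℂ) ^ 2 * Complex.I_sq
  rw [spectrum.mem_iff_quadratic_eq_zero (K := ℂ) (c := (1 : ℂ) ⊗ₜ[ℝ] star x)
      (t := ((2 * x.re : ℝ) : ℂ)) (n := ((Quaternion.normSq x : ℝ) : ℂ)), hfactor, mul_eq_zero,
    sub_eq_zero, sub_eq_zero]
  · rfl
  · rw [← tmul_add, Quaternion.self_add_star', one_tmul_quaternion_coe,
      Algebra.TensorProduct.algebraMap_apply, Algebra.algebraMap_self_apply]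
  · rw [Algebra.TensorProduct.tmul_mul_tmul, one_mul, Quaternion.self_mul_star,
      one_tmul_quaternion_coe,
      Algebra.TensorProduct.algebraMap_apply, Algebra.algebraMap_self_apply]
  · rw [Algebra.TensorProduct.tmul_mul_tmul, one_mul, Quaternion.star_mul_self,
      one_tmul_quaternion_coe,
      Algebra.TensorProduct.algebraMap_apply, Algebra.algebraMap_self_apply]
  · intro w hw
    rw [Algebra.TensorProduct.algebraMap_apply] at hw ⊢
    simpa only [complexifiedConj_tmul, star_one, star_star] using congrArg complexifiedConj hw
end

section
/- Let ℍ := Quaternion ℝ and let M := ℂ ⊗[ℝ] ℍ be the complexification of the quaternion algebra. For all x, y ∈ ℍ the following are equivalent: (i) spectrum ℂ ((1:ℂ) ⊗ₜ x) = spectrum ℂ ((1:ℂ) ⊗ₜ y); (ii) x.re = y.re and ‖x.im‖ = ‖y.im‖; (iii) there exists κ ∈ ℍ with κ.re = 0 and ‖κ‖ = 1 such that y = algebraMap ℝ ℍ x.re + ‖x.im‖ • κ. -/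
open TensorProduct

theorem Quaternion.add_star_eq_algebraMap (x : Quaternion ℝ) :
    x + star x = algebraMap ℝ (Quaternion ℝ) (2 * x.re) := by
  rw [Quaternion.self_add_star']; rfl

theorem Quaternion.mul_star_eq_algebraMap (x : Quaternion ℝ) :
    x * star x = algebraMap ℝ (Quaternion ℝ) (x.re ^ 2 + ‖x.im‖ ^ 2) := by
  have h : x.re ^ 2 + ‖x.im‖ ^ 2 = Quaternion.normSq x := by
    rw [sq ‖x.im‖, ← Quaternion.normSq_eq_norm_mul_self, Quaternion.normSq_def',
      Quaternion.normSq_def']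
    simp
    ring
  rw [Quaternion.self_mul_star, h]; rfl

theorem Quaternion.star_eq_self_of_forall_commute {x : Quaternion ℝ} (h : ∀ q, Commute x q) :
    star x = x := by
  have hJ (q : Quaternion ℝ) := congrArg QuaternionAlgebra.imJ (h q).eq
  have hK (q : Quaternion ℝ) := congrArg QuaternionAlgebra.imK (h q).eq
  simp only [Quaternion.imJ_mul, Quaternion.imK_mul] at hJ hK
  have hIJ := hJ ⟨0, 1, 0, 0⟩
  have hIK := hK ⟨0, 1, 0, 0⟩
  have hJK := hK ⟨0, 0, 1, 0⟩
  ext <;> simp <;> linarith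

section ComplexAlgebra

variable {A : Type*} [Ring A] [Algebra ℂ A] [Algebra ℝ A] [IsScalarTower ℝ ℂ A]

/-- The minimal polynomial of a quaternion, evaluated at a complex scalar, factors through the
quaternion and its conjugate. -/
theorem sub_map_mul_sub_map_star (f : Quaternion ℝ →ₐ[ℝ] A) (x : Quaternion ℝ) (z : ℂ) :
    (algebraMap ℂ A z - f x) * (algebraMap ℂ A z - f (star x)) =
      algebraMap ℂ A ((z - x.re) ^ 2 + (‖x.im‖ : ℂ) ^ 2) := by
  have hreal (r : ℝ) : f (algebraMap ℝ (Quaternion ℝ) r) = algebraMap ℂ A r := by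
    rw [AlgHom.commutes, IsScalarTower.algebraMap_apply ℝ ℂ A]; rfl
  have hexp : (algebraMap ℂ A z - f x) * (algebraMap ℂ A z - f (star x)) =
      algebraMap ℂ A z * algebraMap ℂ A z - algebraMap ℂ A z * f (x + star x) +
        f (x * star x) := by
    rw [map_add, map_mul, sub_mul, mul_sub, mul_sub, mul_add, ← Algebra.commutes z (f x)]
    abel
  rw [hexp, Quaternion.add_star_eq_algebraMap, Quaternion.mul_star_eq_algebraMap, hreal, hreal,
    ← map_mul, ← map_mul, ← map_sub, ← map_add]
  congr 1
  push_cast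
  ring

theorem mem_spectrum_map_quaternion_iff [Nontrivial A] (f : Quaternion ℝ →ₐ[ℝ] A)
    (x : Quaternion ℝ) (z : ℂ) :
    z ∈ spectrum ℂ (f x) ↔ (z - x.re) ^ 2 + (‖x.im‖ : ℂ) ^ 2 = 0 := by
  have hleft := sub_map_mul_sub_map_star f x z
  have hright := sub_map_mul_sub_map_star f (star x) z
  simp only [star_star, Quaternion.re_star, Quaternion.im_star, norm_neg] at hright
  rw [spectrum.mem_iff, not_iff_comm]
  constructor
  · intro hp
    have hu := (IsUnit.mk0 _ hp).map (algebraMap ℂ A)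
    have hc : Commute (algebraMap ℂ A z - f x) (algebraMap ℂ A z - f (star x)) :=
      hleft.trans hright.symm
    exact (hc.isUnit_mul_iff.1 (hleft ▸ hu)).1
  · intro hu hp
    rw [hp, map_zero, hu.mul_right_eq_zero, sub_eq_zero] at hleft
    have hstar : star (star x) = star x := by
      refine Quaternion.star_eq_self_of_forall_commute fun q => f.toRingHom.injective ?_
      change f (star x * q) = f (q * star x)
      rw [map_mul, map_mul, ← hleft, Algebra.commutes]
    rw [hleft, ← hstar, star_star, sub_self] at hu
    exact not_isUnit_zero hu

end ComplexAlgebra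

theorem mem_spectrum_one_tmul_iff (x : Quaternion ℝ) (z : ℂ) :
    z ∈ spectrum ℂ ((1 : ℂ) ⊗ₜ[ℝ] x : ℂ ⊗[ℝ] Quaternion ℝ) ↔
      (z - x.re) ^ 2 + (‖x.im‖ : ℂ) ^ 2 = 0 :=
  mem_spectrum_map_quaternion_iff
    (Algebra.TensorProduct.includeRight : Quaternion ℝ →ₐ[ℝ] ℂ ⊗[ℝ] Quaternion ℝ) x z

theorem re_add_norm_im_mul_I_mem_spectrum (x : Quaternion ℝ) :
    (x.re + ‖x.im‖ * Complex.I : ℂ) ∈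
      spectrum ℂ ((1 : ℂ) ⊗ₜ[ℝ] x : ℂ ⊗[ℝ] Quaternion ℝ) := by
  rw [mem_spectrum_one_tmul_iff, add_sub_cancel_left, mul_pow, Complex.I_sq]
  ring

theorem Quaternion.exists_unit_imaginary_smul_eq (q : Quaternion ℝ) (hq : q.re = 0) :
    ∃ κ : Quaternion ℝ, κ.re = 0 ∧ ‖κ‖ = 1 ∧ q = ‖q‖ • κ := by
  rcases eq_or_ne q 0 with rfl | h
  · exact ⟨Quaternion.coeComplex Complex.I, by simp, by
      simp [← sq_eq_sq₀ (norm_nonneg _) zero_le_one, sq, ← Quaternion.normSq_eq_norm_mul_self,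
        Quaternion.normSq_def'], by rw [norm_zero, zero_smul]⟩
  · exact ⟨‖q‖⁻¹ • q, by simp [hq], norm_smul_inv_norm (𝕜 := ℝ) h,
      (smul_inv_smul₀ (norm_ne_zero_iff.2 h) q).symm⟩

theorem spectrum_eq_iff_quaternion (x y : Quaternion ℝ) :
    (spectrum ℂ ((1 : ℂ) ⊗ₜ[ℝ] x : ℂ ⊗[ℝ] Quaternion ℝ) =
        spectrum ℂ ((1 : ℂ) ⊗ₜ[ℝ] y : ℂ ⊗[ℝ] Quaternion ℝ) ↔
      x.re = y.re ∧ ‖x.im‖ = ‖y.im‖) ∧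
    ((x.re = y.re ∧ ‖x.im‖ = ‖y.im‖) ↔
      ∃ κ : Quaternion ℝ, κ.re = 0 ∧ ‖κ‖ = 1 ∧
        y = algebraMap ℝ (Quaternion ℝ) x.re + ‖x.im‖ • κ) := by
  refine ⟨⟨fun h => ?_, fun ⟨hre, him⟩ => ?_⟩, fun ⟨hre, him⟩ => ?_, ?_⟩
  · have hx := re_add_norm_im_mul_I_mem_spectrum x
    have hy := re_add_norm_im_mul_I_mem_spectrum y
    rw [h, mem_spectrum_one_tmul_iff] at hx
    rw [← h, mem_spectrum_one_tmul_iff] at hy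
    have hx' := congrArg Complex.re hx
    have hy' := congrArg Complex.re hy
    simp [sq] at hx' hy'
    have hre : x.re = y.re := by nlinarith
    refine ⟨hre, (sq_eq_sq₀ (norm_nonneg _) (norm_nonneg _)).1 ?_⟩
    rw [hre] at hx'
    nlinarith
  · ext z
    rw [mem_spectrum_one_tmul_iff, mem_spectrum_one_tmul_iff, hre, him]
  · obtain ⟨κ, hκ, hnorm, hy⟩ := Quaternion.exists_unit_imaginary_smul_eq y.im (by simp)
    refine ⟨κ, hκ, hnorm, ?_⟩
    rw [hre, him, ← hy]
    exact (Quaternion.re_add_im y).symm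
  · rintro ⟨κ, hκ, hnorm, rfl⟩
    have him : κ.im = κ := by ext <;> simp [hκ]
    have hcoe : (algebraMap ℝ (Quaternion ℝ) x.re).im = 0 := Quaternion.im_coe _
    have hcoe' : (algebraMap ℝ (Quaternion ℝ) x.re).re = x.re := Quaternion.re_coe _
    constructor
    · rw [Quaternion.re_add, hcoe', Quaternion.re_smul, hκ, smul_zero, add_zero]
    · rw [Quaternion.im_add, hcoe, Quaternion.im_smul, him, zero_add, norm_smul, hnorm, norm_norm,
        mul_one]
end

section
/- Let A be a nontrivial complete unital real Banach algebra and a ∈ A. Then the quaternionic spectrum σ_ℍ(a) := {q : ℍ | ¬ IsUnit (a^2 − algebraMap ℝ A (2·q.re) * a + algebraMap ℝ A (‖q‖^2))} is a nonempty compact subset of ℍ. -/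
/-- The representation of a real normed algebra `A` on the complex Banach space of bounded
`ℝ`-linear maps `A → ℂ`, in which `a` acts by precomposition with right multiplication by `a`. -/
noncomputable def complexDualRep (A : Type*) [NormedRing A] [NormedAlgebra ℝ A] :
    A →+* ((A →L[ℝ] ℂ) →L[ℂ] (A →L[ℝ] ℂ)) where
  toFun a := LinearMap.mkContinuous
    { toFun := fun φ => φ.comp ((ContinuousLinearMap.mul ℝ A).flip a)
      map_add' := fun φ ψ => by ext; simp
      map_smul' := fun c φ => by ext; simp }
    ‖(ContinuousLinearMap.mul ℝ A).flip a‖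
    fun φ => (φ.opNorm_comp_le _).trans_eq (mul_comm _ _)
  map_one' := by ext; simp
  map_mul' a b := by ext; simp [mul_assoc]
  map_zero' := by ext; simp
  map_add' a b := by ext; simp

theorem complexDualRep_algebraMap {A : Type*} [NormedRing A] [NormedAlgebra ℝ A] (r : ℝ) :
    complexDualRep A (algebraMap ℝ A r) =
      (r : ℂ) • (1 : (A →L[ℝ] ℂ) →L[ℂ] (A →L[ℝ] ℂ)) := by
  ext φ x
  change φ (x * algebraMap ℝ A r) = (r : ℂ) • φ x
  rw [Algebra.algebraMap_eq_smul_one, mul_smul_comm, mul_one, map_smul, Complex.coe_smul]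

theorem nontrivial_realLinear_complex (A : Type*) [NormedAddCommGroup A] [NormedSpace ℝ A]
    [Nontrivial A] : Nontrivial (A →L[ℝ] ℂ) := by
  obtain ⟨x, hx⟩ := exists_ne (0 : A)
  obtain ⟨g, -, hg⟩ := exists_dual_vector ℝ x (norm_ne_zero_iff.mpr hx)
  refine ⟨Complex.ofRealCLM.comp g, 0, fun h => hx ?_⟩
  simpa [hg] using DFunLike.congr_fun h x

theorem sq_sub_two_re_mul_add_normSq {B : Type*} [Ring B] [Algebra ℂ B] (T : B) (z : ℂ) :
    T ^ 2 - algebraMap ℂ B ((2 * z.re : ℝ) : ℂ) * T + algebraMap ℂ B ((‖z‖ ^ 2 : ℝ) : ℂ) =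
      (algebraMap ℂ B z - T) * (algebraMap ℂ B (starRingEnd ℂ z) - T) := by
  rw [← Complex.add_conj, Complex.ofReal_pow, ← Complex.mul_conj', map_add, map_mul, sub_mul,
    mul_sub, mul_sub, ← Algebra.commutes (starRingEnd ℂ z) T]
  noncomm_ring

theorem exists_not_isUnit_of_ringHom {A E : Type*} [Ring A] [Algebra ℝ A]
    [NormedAddCommGroup E] [NormedSpace ℂ E] [CompleteSpace E] [Nontrivial E]
    (f : A →+* (E →L[ℂ] E))
    (hf : ∀ r : ℝ, f (algebraMap ℝ A r) = (r : ℂ) • (1 : E →L[ℂ] E)) (a : A) :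
    ∃ z : ℂ, ¬ IsUnit (a ^ 2 - algebraMap ℝ A (2 * z.re) * a + algebraMap ℝ A (‖z‖ ^ 2)) := by
  obtain ⟨z, hz⟩ := spectrum.nonempty (f a)
  refine ⟨z, fun h => hz ?_⟩
  have h' := h.map f
  rw [map_add, map_sub, map_mul, map_pow, hf, hf, ← Algebra.algebraMap_eq_smul_one,
    ← Algebra.algebraMap_eq_smul_one, sq_sub_two_re_mul_add_normSq] at h'
  refine ((Commute.isUnit_mul_iff ?_).mp h').1
  exact (Algebra.commute_algebraMap_left _ _).sub_left
    ((Algebra.commute_algebraMap_right _ _).sub_right (Commute.refl _))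

/-- Every element of a nontrivial real normed algebra has a complex number `z` at which
the real quadratic polynomial with roots `z` and `conj z` is not invertible. -/
theorem exists_not_isUnit_sq_sub_two_re_mul_add_normSq {A : Type*} [NormedRing A] [Nontrivial A]
    [NormedAlgebra ℝ A] (a : A) :
    ∃ z : ℂ, ¬ IsUnit (a ^ 2 - algebraMap ℝ A (2 * z.re) * a + algebraMap ℝ A (‖z‖ ^ 2)) :=
  have := nontrivial_realLinear_complex A
  exists_not_isUnit_of_ringHom (complexDualRep A) complexDualRep_algebraMap a

theorem norm_le_of_not_isUnit_sq_sub_two_re_mul_add_normSq {A : Type*} [NormedRing A]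
    [CompleteSpace A] [NormOneClass A] [NormedAlgebra ℝ A] (a : A) (q : Quaternion ℝ)
    (hq : ¬ IsUnit (a ^ 2 - algebraMap ℝ A (2 * q.re) * a + algebraMap ℝ A (‖q‖ ^ 2))) :
    ‖q‖ ≤ 3 * ‖a‖ + 1 := by
  contrapose! hq
  have hre : |q.re| ≤ ‖q‖ := by
    refine abs_le_of_sq_le_sq ?_ (norm_nonneg q)
    rw [sq ‖q‖, ← Quaternion.normSq_eq_norm_mul_self, Quaternion.normSq_def']
    nlinarith [sq_nonneg q.imI, sq_nonneg q.imJ, sq_nonneg q.imK]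
  have hb : ‖algebraMap ℝ A (2 * q.re) * a - a ^ 2‖ < ‖‖q‖ ^ 2‖ := by
    calc _ ≤ ‖algebraMap ℝ A (2 * q.re)‖ * ‖a‖ + ‖a‖ ^ 2 :=
          (norm_sub_le _ _).trans (add_le_add (norm_mul_le _ _) (norm_pow_le _ _))
      _ = 2 * |q.re| * ‖a‖ + ‖a‖ ^ 2 := by
          rw [norm_algebraMap', norm_mul, Real.norm_two, Real.norm_eq_abs]
      _ ≤ 2 * ‖q‖ * ‖a‖ + ‖a‖ ^ 2 := by gcongr
      _ < ‖q‖ ^ 2 := by nlinarith [norm_nonneg a]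
      _ = _ := by simp
  have := spectrum.mem_resolventSet_iff.mp (spectrum.mem_resolventSet_of_norm_lt hb)
  rwa [sub_sub_eq_add_sub, add_comm, add_sub_right_comm] at this

theorem quaternionicSpectrum_nonempty_and_compact (A : Type*) [NormedRing A]
    [CompleteSpace A] [Nontrivial A] [NormOneClass A] [NormedAlgebra ℝ A] (a : A) :
    ({q : Quaternion ℝ |
        ¬ IsUnit (a ^ 2 - algebraMap ℝ A (2 * q.re) * a +
          algebraMap ℝ A (‖q‖ ^ 2))}).Nonempty ∧
    IsCompact {q : Quaternion ℝ |
        ¬ IsUnit (a ^ 2 - algebraMap ℝ A (2 * q.re) * a +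
          algebraMap ℝ A (‖q‖ ^ 2))} := by
  constructor
  · obtain ⟨z, hz⟩ := exists_not_isUnit_sq_sub_two_re_mul_add_normSq a
    refine ⟨(z : Quaternion ℝ), ?_⟩
    have hn : ‖(z : Quaternion ℝ)‖ = ‖z‖ := by
      rw [← sq_eq_sq₀ (norm_nonneg _) (norm_nonneg _), sq, ← Quaternion.normSq_eq_norm_mul_self,
        Quaternion.normSq_def', ← Complex.normSq_eq_norm_sq, Complex.normSq_apply]
      simp [sq]
    simpa only [Set.mem_ofPred_eq, hn, Quaternion.re_coeComplex] using hz
  · refine Metric.isCompact_of_isClosed_isBounded ?_ ?_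
    · refine (nonunits.isClosed (R := A)).preimage
        (f := fun q : Quaternion ℝ => a ^ 2 - algebraMap ℝ A (2 * q.re) * a +
          algebraMap ℝ A (‖q‖ ^ 2)) ?_
      have hc := continuous_algebraMap ℝ A
      have hr := Quaternion.continuous_re
      fun_prop
    · exact isBounded_iff_forall_norm_le.mpr
        ⟨_, norm_le_of_not_isUnit_sq_sub_two_re_mul_add_normSq a⟩
end

section
/- Let B be a unital associative complex algebra and let β₁, β₂ ∈ B with β₁ * β₂ = β₂ * β₁, and z₁, z₂ ∈ ℂ (complex scalars regarded in B via algebraMap ℂ B). Set M := !![β₁ − z₁, β₂ − z₂; −β₂ + conj z₂, β₁ − conj z₁] and N := !![β₁ − conj z₁, −β₂ + z₂; β₂ − conj z₂, β₁ − z₁] in Matrix (Fin 2) (Fin 2) B. Then M * N = N * M = s • (1 : Matrix (Fin 2) (Fin 2) B), where s := (β₁ − z₁) * (β₁ − conj z₁) + (β₂ − z₂) * (β₂ − conj z₂). -/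
/-- For pairwise commuting entries, a `2 × 2` matrix times its adjugate, in either order, is the
scalar matrix of its determinant, even over a noncommutative ring. -/
theorem Matrix.mul_adjugate_fin_two_of_commute {R : Type*} [Ring R] {a b c d : R}
    (hab : Commute a b) (hac : Commute a c) (had : Commute a d)
    (hbc : Commute b c) (hbd : Commute b d) (hcd : Commute c d) :
    !![a, b; -d, c] * !![c, -b; d, a] = (a * c + b * d) • (1 : Matrix (Fin 2) (Fin 2) R) ∧
      !![c, -b; d, a] * !![a, b; -d, c] = (a * c + b * d) • (1 : Matrix (Fin 2) (Fin 2) R) := by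
  constructor <;> ext i j <;> fin_cases i <;> fin_cases j <;>
    simp [Matrix.mul_apply, Fin.sum_univ_two, hab.eq, hac.eq, had.eq, hbc.eq, hbd.eq, hcd.eq,
      add_comm]

theorem matrix_quaternion_identity (B : Type*) [Ring B] [Algebra ℂ B]
    (β₁ β₂ : B) (hcomm : β₁ * β₂ = β₂ * β₁) (z₁ z₂ : ℂ) :
    let M : Matrix (Fin 2) (Fin 2) B :=
      !![β₁ - algebraMap ℂ B z₁, β₂ - algebraMap ℂ B z₂;
         -β₂ + algebraMap ℂ B ((starRingEnd ℂ) z₂), β₁ - algebraMap ℂ B ((starRingEnd ℂ) z₁)]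
    let N : Matrix (Fin 2) (Fin 2) B :=
      !![β₁ - algebraMap ℂ B ((starRingEnd ℂ) z₁), -β₂ + algebraMap ℂ B z₂;
         β₂ - algebraMap ℂ B ((starRingEnd ℂ) z₂), β₁ - algebraMap ℂ B z₁]
    let s : B := (β₁ - algebraMap ℂ B z₁) * (β₁ - algebraMap ℂ B ((starRingEnd ℂ) z₁)) +
      (β₂ - algebraMap ℂ B z₂) * (β₂ - algebraMap ℂ B ((starRingEnd ℂ) z₂))
    M * N = s • (1 : Matrix (Fin 2) (Fin 2) B) ∧
      N * M = s • (1 : Matrix (Fin 2) (Fin 2) B) := by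
  intro M N s
  have h (x : B) (z : ℂ) : Commute x (algebraMap ℂ B z) := Algebra.commute_algebraMap_right z x
  have hsub {x y : B} (hxy : Commute x y) (z w : ℂ) :
      Commute (x - algebraMap ℂ B z) (y - algebraMap ℂ B w) :=
    (hxy.sub_right (h x w)).sub_left (h _ z).symm
  have hneg (z : ℂ) : -β₂ + algebraMap ℂ B z = -(β₂ - algebraMap ℂ B z) := by abel
  simp only [M, N, s, hneg]
  exact Matrix.mul_adjugate_fin_two_of_commute (hsub hcomm _ _) (hsub (.refl _) _ _)
    (hsub hcomm _ _) (hsub hcomm.symm _ _) (hsub (.refl _) _ _) (hsub hcomm _ _)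
end

section
/- Let ℍ := Quaternion ℝ, let M := ℂ ⊗[ℝ] ℍ be the complexification of the quaternion algebra, and let q ∈ ℍ with q.im ≠ 0. Set κ := ‖q.im‖⁻¹ • q.im ∈ ℍ, and in M set ι₊ := (2:ℂ)⁻¹ • ((1 : M) − Complex.I • ((1:ℂ) ⊗ₜ κ)) and ι₋ := (2:ℂ)⁻¹ • ((1 : M) + Complex.I • ((1:ℂ) ⊗ₜ κ)). Then ι₊ + ι₋ = 1, ι₊ * ι₋ = 0, ι₊ * ι₊ = ι₊, ι₋ * ι₋ = ι₋, and (1:ℂ) ⊗ₜ q = ((q.re : ℂ) + ‖q.im‖ * Complex.I) • ι₊ + ((q.re : ℂ) − ‖q.im‖ * Complex.I) • ι₋. -/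
open TensorProduct

theorem Complex.ofReal_smul_one_tmul {V : Type*} [AddCommGroup V] [Module ℝ V] (r : ℝ) (v : V) :
    (r : ℂ) • ((1 : ℂ) ⊗ₜ[ℝ] v) = (1 : ℂ) ⊗ₜ[ℝ] (r • v) := by
  rw [TensorProduct.smul_tmul', ← TensorProduct.smul_tmul, Complex.real_smul, smul_eq_mul]

theorem Quaternion.inv_norm_smul_im_mul_self {q : Quaternion ℝ} (hq : q.im ≠ 0) :
    (‖q.im‖⁻¹ • q.im) * (‖q.im‖⁻¹ • q.im) = -1 := by
  have hn : ‖q.im‖ ≠ 0 := norm_ne_zero_iff.mpr hq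
  have h : q.im * q.im = -(((‖q.im‖ * ‖q.im‖ : ℝ)) • (1 : Quaternion ℝ)) := by
    rw [← sq, Quaternion.im_sq, Quaternion.normSq_eq_norm_mul_self, ← Algebra.algebraMap_eq_smul_one]
    rfl
  rw [smul_mul_smul_comm, h, smul_neg, smul_smul, ← mul_inv,
    inv_mul_cancel₀ (mul_ne_zero hn hn), one_smul]

/-- In a complex algebra, the elements `(1 ∓ i k) / 2` attached to a square root `k` of `-1` are
complementary orthogonal idempotents. -/
theorem half_one_sub_add_I_smul_idempotents {A : Type*} [Ring A] [Algebra ℂ A] {k : A}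
    (hk : k * k = -1) :
    let p : A := (2 : ℂ)⁻¹ • (1 - Complex.I • k)
    let m : A := (2 : ℂ)⁻¹ • (1 + Complex.I • k)
    p + m = 1 ∧ p * m = 0 ∧ p * p = p ∧ m * m = m := by
  have hI : (Complex.I • k) * (Complex.I • k) = 1 := by
    rw [smul_mul_smul_comm, hk, Complex.I_mul_I, neg_smul, one_smul, neg_neg]
  generalize Complex.I • k = j at hI
  refine ⟨by module, ?_, ?_, ?_⟩
  · simp only [smul_mul_smul_comm, mul_add, sub_mul, hI, one_mul, mul_one]
    module
  · simp only [smul_mul_smul_comm, mul_sub, sub_mul, hI, one_mul, mul_one]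
    module
  · simp only [smul_mul_smul_comm, mul_add, add_mul, hI, one_mul, mul_one]
    module

theorem smul_half_one_sub_I_smul_add_smul_half_one_add_I_smul {A : Type*} [Ring A] [Algebra ℂ A]
    (a b : ℂ) (k : A) :
    (a + b * Complex.I) • ((2 : ℂ)⁻¹ • (1 - Complex.I • k)) +
      (a - b * Complex.I) • ((2 : ℂ)⁻¹ • (1 + Complex.I • k)) = a • (1 : A) + b • k := by
  match_scalars
  · ring
  · linear_combination -b * Complex.I_sq

theorem quaternion_idempotent_decomposition (q : Quaternion ℝ) (hq : q.im ≠ 0) :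
    let κ : Quaternion ℝ := ‖q.im‖⁻¹ • q.im
    let ιp : ℂ ⊗[ℝ] Quaternion ℝ :=
      (2 : ℂ)⁻¹ • ((1 : ℂ ⊗[ℝ] Quaternion ℝ) - Complex.I • ((1 : ℂ) ⊗ₜ[ℝ] κ))
    let ιm : ℂ ⊗[ℝ] Quaternion ℝ :=
      (2 : ℂ)⁻¹ • ((1 : ℂ ⊗[ℝ] Quaternion ℝ) + Complex.I • ((1 : ℂ) ⊗ₜ[ℝ] κ))
    ιp + ιm = 1 ∧ ιp * ιm = 0 ∧ ιp * ιp = ιp ∧ ιm * ιm = ιm ∧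
      (1 : ℂ) ⊗ₜ[ℝ] q = ((q.re : ℂ) + ‖q.im‖ * Complex.I) • ιp +
        ((q.re : ℂ) - ‖q.im‖ * Complex.I) • ιm := by
  intro κ ιp ιm
  have hκ : ((1 : ℂ) ⊗ₜ[ℝ] κ) * ((1 : ℂ) ⊗ₜ[ℝ] κ) = -1 := by
    rw [Algebra.TensorProduct.tmul_mul_tmul, Quaternion.inv_norm_smul_im_mul_self hq, one_mul,
      TensorProduct.tmul_neg, Algebra.TensorProduct.one_def]
  obtain ⟨h_sum, h_orth, h_p, h_m⟩ :=
    half_one_sub_add_I_smul_idempotents (A := ℂ ⊗[ℝ] Quaternion ℝ) hκ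
  refine ⟨h_sum, h_orth, h_p, h_m, ?_⟩
  have hdecomp : q = q.re • (1 : Quaternion ℝ) + ‖q.im‖ • κ := by
    rw [smul_inv_smul₀ (norm_ne_zero_iff.mpr hq), ← Algebra.algebraMap_eq_smul_one]
    exact (Quaternion.re_add_im q).symm
  refine Eq.trans ?_ (smul_half_one_sub_I_smul_add_smul_half_one_add_I_smul
    (A := ℂ ⊗[ℝ] Quaternion ℝ) (q.re : ℂ) (‖q.im‖ : ℂ) ((1 : ℂ) ⊗ₜ[ℝ] κ)).symm
  rw [Algebra.TensorProduct.one_def, Complex.ofReal_smul_one_tmul, Complex.ofReal_smul_one_tmul,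
    ← TensorProduct.tmul_add, ← hdecomp]
end

section
/- Let U ⊆ ℂ be an open conjugate symmetric set (z ∈ U implies conj z ∈ U), and let f : ℂ → ℂ be continuous on U and satisfy the stem property f (conj z) = conj (f z) for all z ∈ U. Suppose that for every quaternion q ∈ ℍ with q.im ≠ 0 and (q.re : ℂ) + ‖q.im‖ * Complex.I ∈ U, the quaternion (f ((q.re:ℂ) + ‖q.im‖*Complex.I)).re • (1 : ℍ) + ((f ((q.re:ℂ) + ‖q.im‖*Complex.I)).im / ‖q.im‖) • q.im equals 0. Then f z = 0 for every z ∈ U. -/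
open Filter Topology in
/-- A function continuous on an open set and vanishing at its points above the real axis also
vanishes at its real points. -/
lemma eq_zero_of_im_eq_zero_of_forall_im_pos {U : Set ℂ} (hU : IsOpen U) {f : ℂ → ℂ}
    (hf : ContinuousOn f U) (hpos : ∀ z ∈ U, 0 < z.im → f z = 0) {z : ℂ} (hz : z ∈ U)
    (him : z.im = 0) : f z = 0 := by
  have hpath : Tendsto (fun t : ℝ => z + t * Complex.I) (𝓝[>] 0) (𝓝 z) := by
    have hcont : Continuous fun t : ℝ => z + t * Complex.I := by fun_prop
    simpa using (hcont.tendsto 0).mono_left nhdsWithin_le_nhds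
  have hlim := (hf.continuousAt (hU.mem_nhds hz)).tendsto.comp hpath
  refine tendsto_nhds_unique_of_eventuallyEq hlim (tendsto_const_nhds (x := (0 : ℂ))) ?_
  filter_upwards [hpath.eventually (hU.mem_nhds hz), self_mem_nhdsWithin] with t ht ht0
  exact hpos _ ht (by simpa [him] using ht0)

theorem stem_function_slice_extension_injective (U : Set ℂ) (hU : IsOpen U)
    (hUsym : ∀ z ∈ U, (starRingEnd ℂ) z ∈ U) (f : ℂ → ℂ) (hf : ContinuousOn f U)
    (hstem : ∀ z ∈ U, f ((starRingEnd ℂ) z) = (starRingEnd ℂ) (f z))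
    (hzero : ∀ q : Quaternion ℝ, q.im ≠ 0 →
      (q.re : ℂ) + ‖q.im‖ * Complex.I ∈ U →
      (f ((q.re : ℂ) + ‖q.im‖ * Complex.I)).re • (1 : Quaternion ℝ) +
        ((f ((q.re : ℂ) + ‖q.im‖ * Complex.I)).im / ‖q.im‖) • q.im = 0) :
    ∀ z ∈ U, f z = 0 := by
  have hpos : ∀ z ∈ U, 0 < z.im → f z = 0 := by
    intro z hz him
    let q : Quaternion ℝ := ⟨z.re, z.im, 0, 0⟩
    have hI : q.imI = z.im := rfl
    have hnorm : ‖q.im‖ = z.im := by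
      have h := Quaternion.normSq_eq_norm_mul_self q.im
      rw [Quaternion.normSq_def'] at h
      have hJ : q.imJ = 0 := rfl
      have hK : q.imK = 0 := rfl
      rw [Quaternion.re_im, Quaternion.imI_im, Quaternion.imJ_im, Quaternion.imK_im,
        hI, hJ, hK] at h
      nlinarith [norm_nonneg q.im]
    have hq : q.im ≠ 0 := by
      rw [← norm_ne_zero_iff, hnorm]
      exact him.ne'
    have hpoint : (q.re : ℂ) + ‖q.im‖ * Complex.I = z := by
      rw [hnorm]
      exact Complex.re_add_im z
    have h := hzero q hq (by rwa [hpoint])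
    rw [hpoint, hnorm] at h
    have hre := congrArg QuaternionAlgebra.re h
    have himI := congrArg QuaternionAlgebra.imI h
    apply Complex.ext
    · simpa [Quaternion.re_one, Quaternion.re_zero] using hre
    · simpa [hI, him.ne', Quaternion.imI_one, Quaternion.imI_zero] using himI
  intro z hz
  rcases lt_trichotomy z.im 0 with him | him | him
  · have h := hpos _ (hUsym z hz) (by simpa using him)
    rw [hstem z hz] at h
    simpa using h
  · exact eq_zero_of_im_eq_zero_of_forall_im_pos hU hf hpos hz him
  · exact hpos z hz him
end
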